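/- (Proposition 4.3.) Assume the nominal closed loop is exponentially stable, i.e. there exists δ > 0 such that every λ ∈ ℂ with H₀(λ) = 0 satisfies Re λ ≤ −δ, and assume C·B = 0 (the m×p zero matrix). Then the unfiltered closed loop is strongly stable: for every perturbation triple (R₁, R₂, R₃) there exist r̂ > 0 and c > 0 such that for all r₁, r₂, r₃ ∈ (0, r̂), every λ ∈ ℂ with Re λ > −c satisfies H₅(λ; r₁, r₂, r₃) ≠ 0. -/

import Mathlib

open Matrix

attribute [local instance] Matrix.normedAddCommGroup

/-- A real matrix regarded as a complex matrix. -/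
noncomputable def cM {a b : ℕ} (M : Matrix (Fin a) (Fin b) ℝ) : Matrix (Fin a) (Fin b) ℂ :=
  M.map (fun x => (x : ℂ))

/-- The nominal closed-loop characteristic function `H₀`. -/
noncomputable def H0 {n m p q K : ℕ}
    (A0 : Matrix (Fin n) (Fin n) ℝ) (A : Fin K → Matrix (Fin n) (Fin n) ℝ)
    (τ : Fin K → ℝ)
    (B : Matrix (Fin n) (Fin m) ℝ) (C : Matrix (Fin p) (Fin n) ℝ)
    (Kp Kd : Matrix (Fin m) (Fin p) ℝ)
    (Ui : Matrix (Fin m) (Fin q) ℝ) (Vi : Matrix (Fin q) (Fin p) ℝ)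
    (lam : ℂ) : ℂ :=
  (lam • Matrix.fromBlocks (1 - cM B * cM Kd * cM C) 0 0 (1 : Matrix (Fin q) (Fin q) ℂ)
    - Matrix.fromBlocks (cM A0 + cM B * cM Kp * cM C) (cM B * cM Ui) (cM Vi * cM C) 0
    - ∑ k : Fin K, Complex.exp (-lam * (τ k : ℂ)) •
        Matrix.fromBlocks (cM (A k)) 0 0 (0 : Matrix (Fin q) (Fin q) ℂ)).det

/-- An admissible perturbation family of size `s`: for each perturbation
parameter `r ≥ 0`, a matrix-valued function of `λ` that is entrywise meromorphic
in `λ`, continuous in `r`, equal to the identity at `r = 0`, converging to the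
identity uniformly on compact sets as `r → 0+`, and uniformly bounded on a right
half-plane for small `r`. -/
structure Admissible (s : ℕ) (R : ℂ → ℝ → Matrix (Fin s) (Fin s) ℂ) : Prop where
  merom : ∀ r : ℝ, 0 ≤ r → ∀ i j : Fin s, MeromorphicOn (fun lam => R lam r i j) Set.univ
  cont : ∀ (lam : ℂ) (i j : Fin s), ContinuousOn (fun r => R lam r i j) (Set.Ici 0)
  id_at_zero : ∀ lam : ℂ, R lam 0 = 1
  unif_conv : ∀ Ω : Set ℂ, IsCompact Ω → ∀ ε : ℝ, 0 < ε → ∃ δ : ℝ, 0 < δ ∧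
    ∀ r : ℝ, 0 < r → r < δ → ∀ lam ∈ Ω, ‖R lam r - 1‖ ≤ ε
  bounded : ∃ M N rbar : ℝ, 0 < M ∧ 0 < N ∧ 0 < rbar ∧
    ∀ lam : ℂ, -N ≤ lam.re → ∀ r : ℝ, 0 < r → r < rbar → ‖R lam r‖ ≤ M

/-- The perturbed unfiltered characteristic function `H₅(λ; r₁, r₂, r₃)`. -/
noncomputable def H5 {n m p q K : ℕ}
    (A0 : Matrix (Fin n) (Fin n) ℝ) (A : Fin K → Matrix (Fin n) (Fin n) ℝ)
    (τ : Fin K → ℝ)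
    (B : Matrix (Fin n) (Fin m) ℝ) (C : Matrix (Fin p) (Fin n) ℝ)
    (Kp Kd : Matrix (Fin m) (Fin p) ℝ)
    (Ui : Matrix (Fin m) (Fin q) ℝ) (Vi : Matrix (Fin q) (Fin p) ℝ)
    (R1 : ℂ → ℝ → Matrix (Fin m) (Fin m) ℂ)
    (R2 R3 : ℂ → ℝ → Matrix (Fin p) (Fin p) ℂ)
    (lam : ℂ) (r1 r2 r3 : ℝ) : ℂ :=
  (lam • Matrix.fromBlocks
      (1 - cM B * R1 lam r1 * cM Kd * R2 lam r2 * R3 lam r3 * cM C) 0 0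
      (1 : Matrix (Fin q) (Fin q) ℂ)
    - Matrix.fromBlocks (cM A0) 0 0 (0 : Matrix (Fin q) (Fin q) ℂ)
    - ∑ k : Fin K, Complex.exp (-lam * (τ k : ℂ)) •
        Matrix.fromBlocks (cM (A k)) 0 0 (0 : Matrix (Fin q) (Fin q) ℂ)
    - Matrix.fromBlocks (cM B * R1 lam r1) 0 0 (1 : Matrix (Fin q) (Fin q) ℂ)
      * Matrix.fromBlocks (cM Kp) (cM Ui) (cM Vi) (0 : Matrix (Fin q) (Fin q) ℂ)
      * Matrix.fromBlocks (R3 lam r3 * cM C) 0 0 (1 : Matrix (Fin q) (Fin q) ℂ)).det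

noncomputable def GG {n m p q K : ℕ}
    (A0 : Matrix (Fin n) (Fin n) ℝ) (A : Fin K → Matrix (Fin n) (Fin n) ℝ)
    (B : Matrix (Fin n) (Fin m) ℝ) (C : Matrix (Fin p) (Fin n) ℝ)
    (Kp Kd : Matrix (Fin m) (Fin p) ℝ)
    (Ui : Matrix (Fin m) (Fin q) ℝ) (Vi : Matrix (Fin q) (Fin p) ℝ)
    (a b : ℂ) (e : Fin K → ℂ) (X : Matrix (Fin m) (Fin m) ℂ)
    (Y Z : Matrix (Fin p) (Fin p) ℂ) : Matrix (Fin n ⊕ Fin q) (Fin n ⊕ Fin q) ℂ :=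
  a • Matrix.fromBlocks
      (1 - cM B * X * cM Kd * Y * Z * cM C) 0 0
      (1 : Matrix (Fin q) (Fin q) ℂ)
    - b • (Matrix.fromBlocks (cM A0) 0 0 (0 : Matrix (Fin q) (Fin q) ℂ)
    + ∑ k : Fin K, e k •
        Matrix.fromBlocks (cM (A k)) 0 0 (0 : Matrix (Fin q) (Fin q) ℂ)
    + Matrix.fromBlocks (cM B * X) 0 0 (1 : Matrix (Fin q) (Fin q) ℂ)
      * Matrix.fromBlocks (cM Kp) (cM Ui) (cM Vi) (0 : Matrix (Fin q) (Fin q) ℂ)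
      * Matrix.fromBlocks (Z * cM C) 0 0 (1 : Matrix (Fin q) (Fin q) ℂ))

abbrev Par (m p K : ℕ) : Type :=
  (Fin K → ℂ) × Matrix (Fin m) (Fin m) ℂ × Matrix (Fin p) (Fin p) ℂ × Matrix (Fin p) (Fin p) ℂ

theorem GG_cont {n m p q K : ℕ}
    (A0 : Matrix (Fin n) (Fin n) ℝ) (A : Fin K → Matrix (Fin n) (Fin n) ℝ)
    (B : Matrix (Fin n) (Fin m) ℝ) (C : Matrix (Fin p) (Fin n) ℝ)
    (Kp Kd : Matrix (Fin m) (Fin p) ℝ)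
    (Ui : Matrix (Fin m) (Fin q) ℝ) (Vi : Matrix (Fin q) (Fin p) ℝ)
    {T : Type*} [TopologicalSpace T]
    {a b : T → ℂ} {e : T → Fin K → ℂ} {X : T → Matrix (Fin m) (Fin m) ℂ}
    {Y Z : T → Matrix (Fin p) (Fin p) ℂ}
    (ha : Continuous a) (hb : Continuous b) (he : Continuous e) (hX : Continuous X)
    (hY : Continuous Y) (hZ : Continuous Z) :
    Continuous (fun t => (GG A0 A B C Kp Kd Ui Vi (a t) (b t) (e t) (X t) (Y t) (Z t)).det) := by
  apply Continuous.matrix_det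
  unfold GG
  have hc : ∀ {i j : ℕ} (M : Matrix (Fin i) (Fin j) ℂ), Continuous (fun _ : T => M) :=
    fun M => continuous_const
  have hek : ∀ k, Continuous (fun t => e t k) := fun k => (continuous_apply k).comp he
  refine (ha.smul ?_).sub (hb.smul ((continuous_const.add ?_).add ?_))
  · refine Continuous.matrix_fromBlocks ?_ (hc _) (hc _) (hc _)
    exact (hc _).sub ((((((hc _).matrix_mul hX).matrix_mul (hc _)).matrix_mul hY).matrix_mul
      hZ).matrix_mul (hc _))
  · exact continuous_finsetSum _ (fun k _ => (hek k).smul continuous_const)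
  · refine (Continuous.matrix_mul ?_ continuous_const).matrix_mul ?_
    · exact Continuous.matrix_fromBlocks ((hc _).matrix_mul hX) (hc _) (hc _) (hc _)
    · exact Continuous.matrix_fromBlocks (hZ.matrix_mul (hc _)) (hc _) (hc _) (hc _)

theorem GG_one {n m p q K : ℕ}
    (A0 : Matrix (Fin n) (Fin n) ℝ) (A : Fin K → Matrix (Fin n) (Fin n) ℝ)
    (B : Matrix (Fin n) (Fin m) ℝ) (C : Matrix (Fin p) (Fin n) ℝ)
    (Kp Kd : Matrix (Fin m) (Fin p) ℝ)
    (Ui : Matrix (Fin m) (Fin q) ℝ) (Vi : Matrix (Fin q) (Fin p) ℝ)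
    (hCB : C * B = 0)
    (e : Fin K → ℂ) (X : Matrix (Fin m) (Fin m) ℂ)
    (Y Z : Matrix (Fin p) (Fin p) ℂ) :
    (GG A0 A B C Kp Kd Ui Vi 1 0 e X Y Z).det = 1 := by
  have h : cM C * cM B = 0 := by
    have := congrArg cM hCB
    unfold cM at *
    rw [show (fun x : ℝ => (x : ℂ)) = Complex.ofRealHom from rfl] at *
    rw [Matrix.map_mul] at this
    rw [this]; ext; simp
  unfold GG
  rw [zero_smul, sub_zero, one_smul, Matrix.det_fromBlocks_zero₂₁, Matrix.det_one, mul_one]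
  rw [Matrix.det_one_sub_mul_comm]
  simp only [← Matrix.mul_assoc]
  rw [h]; simp

theorem ball_compact (s : ℕ) (M : ℝ) :
    IsCompact {R : Matrix (Fin s) (Fin s) ℂ | ‖R‖ ≤ M} := by
  have : IsCompact (Set.pi Set.univ (fun _ : Fin s => Set.pi Set.univ
      (fun _ : Fin s => Metric.closedBall (0:ℂ) |M|))) :=
    isCompact_univ_pi (fun _ => isCompact_univ_pi (fun _ => isCompact_closedBall _ _))
  refine IsCompact.of_isClosed_subset (this : IsCompact (X := Matrix (Fin s) (Fin s) ℂ) _) ?_ ?_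
  · exact isClosed_le continuous_norm continuous_const
  · intro R hR i _ j _
    simp only [Metric.mem_closedBall, dist_zero_right]
    exact (Matrix.norm_entry_le_entrywise_sup_norm R).trans (le_trans hR (le_abs_self M))

theorem small_nhds (s : ℕ) (R : ℂ → ℝ → Matrix (Fin s) (Fin s) ℂ) (hR : Admissible s R)
    (Ω : Set ℂ) (hΩ : IsCompact Ω) (V : Set (Matrix (Fin s) (Fin s) ℂ))
    (hV : V ∈ nhds (1 : Matrix (Fin s) (Fin s) ℂ)) :
    ∃ δ : ℝ, 0 < δ ∧ ∀ r : ℝ, 0 < r → r < δ → ∀ lam ∈ Ω, R lam r ∈ V := by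
  obtain ⟨ε, hε, h⟩ := Metric.nhds_basis_closedBall.mem_iff.1 hV
  obtain ⟨δ, hδ, h2⟩ := hR.unif_conv Ω hΩ ε hε
  refine ⟨δ, hδ, fun r h0 h1 lam hl => h ?_⟩
  rw [Metric.mem_closedBall, dist_eq_norm]
  exact h2 r h0 h1 lam hl

theorem stmt9 {n m p q K : ℕ}
    (hn : 0 < n) (hm : 0 < m) (hp : 0 < p) (hK : 0 < K)
    (A0 : Matrix (Fin n) (Fin n) ℝ) (A : Fin K → Matrix (Fin n) (Fin n) ℝ)
    (τ : Fin K → ℝ) (hτpos : ∀ k, 0 < τ k) (hτmono : StrictMono τ)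
    (B : Matrix (Fin n) (Fin m) ℝ) (hB : B.rank = m)
    (C : Matrix (Fin p) (Fin n) ℝ) (hC : C.rank = p)
    (Kp Kd Ki : Matrix (Fin m) (Fin p) ℝ)
    (Ui : Matrix (Fin m) (Fin q) ℝ) (Vi : Matrix (Fin q) (Fin p) ℝ)
    (hfact : Ki = Ui * Vi) (hUi : Ui.rank = q) (hVi : Vi.rank = q) (hKi : Ki.rank = q)
    (hstab : ∃ δ : ℝ, 0 < δ ∧ ∀ lam : ℂ,
      H0 A0 A τ B C Kp Kd Ui Vi lam = 0 → lam.re ≤ -δ)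
    (hCB : C * B = 0) :
    ∀ (R1 : ℂ → ℝ → Matrix (Fin m) (Fin m) ℂ)
      (R2 R3 : ℂ → ℝ → Matrix (Fin p) (Fin p) ℂ),
      Admissible m R1 → Admissible p R2 → Admissible p R3 →
      (∀ (lam : ℂ) (r : ℝ), 0 ≤ r → IsUnit (R1 lam r)) →
      (∀ (lam : ℂ) (r : ℝ), 0 ≤ r → IsUnit (R3 lam r)) →
      ∃ rhat c : ℝ, 0 < rhat ∧ 0 < c ∧
        ∀ r1 r2 r3 : ℝ, 0 < r1 → r1 < rhat → 0 < r2 → r2 < rhat → 0 < r3 → r3 < rhat →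
          ∀ lam : ℂ, -c < lam.re →
            H5 A0 A τ B C Kp Kd Ui Vi R1 R2 R3 lam r1 r2 r3 ≠ 0 := by
  intro R1 R2 R3 h1 h2 h3 _ _
  obtain ⟨δ, hδ, hst⟩ := hstab
  obtain ⟨M1, N1, b1, hM1, hN1, hb1, hbd1⟩ := h1.bounded
  obtain ⟨M2, N2, b2, hM2, hN2, hb2, hbd2⟩ := h2.bounded
  obtain ⟨M3, N3, b3, hM3, hN3, hb3, hbd3⟩ := h3.bounded
  obtain ⟨c, hc, hcδ, hc1, hc2, hc3⟩ :
      ∃ c : ℝ, 0 < c ∧ c < δ ∧ c ≤ N1 ∧ c ≤ N2 ∧ c ≤ N3 := by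
    refine ⟨min (δ / 2) (min N1 (min N2 N3)), by positivity, ?_, ?_, ?_, ?_⟩
    · exact (min_le_left _ _).trans_lt (by linarith)
    · simp
    · simp
    · simp
  let ex : ℂ → Fin K → ℂ := fun lam k => Complex.exp (-lam * (τ k : ℂ))
  have hex : Continuous ex := by
    apply continuous_pi; intro k; simp only [ex]; fun_prop
  have H5eq : ∀ lam r1 r2 r3, H5 A0 A τ B C Kp Kd Ui Vi R1 R2 R3 lam r1 r2 r3 =
      (GG A0 A B C Kp Kd Ui Vi lam 1 (ex lam) (R1 lam r1) (R2 lam r2) (R3 lam r3)).det := by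
    intro lam r1 r2 r3
    unfold H5 GG
    congr 1
    rw [one_smul]; abel
  have H0eq : ∀ lam, H0 A0 A τ B C Kp Kd Ui Vi lam =
      (GG A0 A B C Kp Kd Ui Vi lam 1 (ex lam) 1 1 1).det := by
    intro lam
    unfold H0 GG
    congr 1
    have : Matrix.fromBlocks (cM A0 + cM B * cM Kp * cM C) (cM B * cM Ui) (cM Vi * cM C)
          (0 : Matrix (Fin q) (Fin q) ℂ) =
        Matrix.fromBlocks (cM A0) 0 0 (0 : Matrix (Fin q) (Fin q) ℂ) +
        Matrix.fromBlocks (cM B * (1 : Matrix (Fin m) (Fin m) ℂ)) 0 0 (1 : Matrix (Fin q) (Fin q) ℂ)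
          * Matrix.fromBlocks (cM Kp) (cM Ui) (cM Vi) (0 : Matrix (Fin q) (Fin q) ℂ)
          * Matrix.fromBlocks ((1 : Matrix (Fin p) (Fin p) ℂ) * cM C) 0 0 (1 : Matrix (Fin q) (Fin q) ℂ) := by
      simp [Matrix.fromBlocks_multiply, Matrix.fromBlocks_add]
    rw [this]
    simp only [Matrix.mul_one, one_smul, ex]
    abel
  -- large lam
  let Q : Set (Par m p K) := (Set.pi Set.univ
      (fun k => Metric.closedBall (0:ℂ) (Real.exp (c * τ k)))) ×ˢ
      ({R | ‖R‖ ≤ M1} ×ˢ ({R | ‖R‖ ≤ M2} ×ˢ {R | ‖R‖ ≤ M3}))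
  have hQ : IsCompact Q := (isCompact_univ_pi (fun k => isCompact_closedBall _ _)).prod
    ((ball_compact m M1).prod ((ball_compact p M2).prod (ball_compact p M3)))
  have hcontA : Continuous (fun t : ℂ × Par m p K =>
      (GG A0 A B C Kp Kd Ui Vi 1 t.1 t.2.1 t.2.2.1 t.2.2.2.1 t.2.2.2.2).det) :=
    GG_cont A0 A B C Kp Kd Ui Vi continuous_const (by fun_prop) (by fun_prop) (by fun_prop)
      (by fun_prop) (by fun_prop)
  have hopA := (isOpen_compl_singleton (x := (0:ℂ))).preimage hcontA
  obtain ⟨u, v, hu, hv, hsu, hQv, huv⟩ := generalized_tube_lemma (isCompact_singleton (x := (0:ℂ)))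
    hQ hopA (by
      rintro ⟨t, P⟩ ⟨ht, -⟩
      obtain rfl : t = 0 := ht
      simp only [Set.mem_preimage, Set.mem_compl_iff, Set.mem_singleton_iff]
      rw [GG_one A0 A B C Kp Kd Ui Vi hCB]
      exact one_ne_zero)
  obtain ⟨ε, hε, hεu⟩ := Metric.isOpen_iff.1 hu 0 (hsu rfl)
  -- compact part
  let Ω : Set ℂ := Metric.closedBall 0 ε⁻¹ ∩ {z | -c ≤ z.re}
  have hΩ : IsCompact Ω := (isCompact_closedBall _ _).inter_right
    (isClosed_le continuous_const Complex.continuous_re)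
  have hcontB : Continuous (fun t : ℂ × (Matrix (Fin m) (Fin m) ℂ ×
      Matrix (Fin p) (Fin p) ℂ × Matrix (Fin p) (Fin p) ℂ) =>
      (GG A0 A B C Kp Kd Ui Vi t.1 1 (ex t.1) t.2.1 t.2.2.1 t.2.2.2).det) :=
    GG_cont A0 A B C Kp Kd Ui Vi (by fun_prop) (by fun_prop) (by fun_prop) (by fun_prop)
      (by fun_prop) (by fun_prop)
  have hopB := (isOpen_compl_singleton (x := (0:ℂ))).preimage hcontB
  obtain ⟨u', v', hu', hv', hsu', hv1, huv'⟩ := generalized_tube_lemma hΩ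
    (isCompact_singleton (x := ((1, 1, 1) : Matrix (Fin m) (Fin m) ℂ ×
      Matrix (Fin p) (Fin p) ℂ × Matrix (Fin p) (Fin p) ℂ))) hopB (by
      rintro ⟨t, P⟩ ⟨ht, hP⟩
      obtain rfl : P = (1, 1, 1) := hP
      simp only [Set.mem_preimage, Set.mem_compl_iff, Set.mem_singleton_iff]
      rw [← H0eq]
      intro h0
      have := hst _ h0
      have h' : -c ≤ t.re := ht.2
      linarith)
  have hv1' : v' ∈ nhds ((1, 1, 1) : Matrix (Fin m) (Fin m) ℂ ×
      Matrix (Fin p) (Fin p) ℂ × Matrix (Fin p) (Fin p) ℂ) := hv'.mem_nhds (hv1 rfl)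
  obtain ⟨V1, hV1, W, hW, hVW⟩ := mem_nhds_prod_iff.1 hv1'
  obtain ⟨V2, hV2, V3, hV3, hVV⟩ := mem_nhds_prod_iff.1 hW
  obtain ⟨d1, hd1, hs1⟩ := small_nhds m R1 h1 Ω hΩ V1 hV1
  obtain ⟨d2, hd2, hs2⟩ := small_nhds p R2 h2 Ω hΩ V2 hV2
  obtain ⟨d3, hd3, hs3⟩ := small_nhds p R3 h3 Ω hΩ V3 hV3
  refine ⟨min (min b1 (min b2 b3)) (min d1 (min d2 d3)), c, by positivity, hc, ?_⟩
  intro r1 r2 r3 p1 l1 p2 l2 p3 l3 lam hlam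
  simp only [lt_min_iff] at l1 l2 l3
  rw [H5eq]
  by_cases hL : ‖lam‖ ≤ ε⁻¹
  · have hmem : lam ∈ Ω := ⟨by simpa using hL, hlam.le⟩
    have := @huv' (lam, R1 lam r1, R2 lam r2, R3 lam r3) ⟨hsu' hmem, hVW
      ⟨hs1 r1 p1 l1.2.1 lam hmem, hVV ⟨hs2 r2 p2 l2.2.2.1 lam hmem,
        hs3 r3 p3 l3.2.2.2 lam hmem⟩⟩⟩
    exact this
  · push Not at hL
    have hpos : 0 < ‖lam‖ := (inv_pos.2 hε).trans hL
    have hne : lam ≠ 0 := norm_pos_iff.1 hpos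
    have hscale : GG A0 A B C Kp Kd Ui Vi lam 1 (ex lam) (R1 lam r1) (R2 lam r2) (R3 lam r3) =
        lam • GG A0 A B C Kp Kd Ui Vi 1 lam⁻¹ (ex lam) (R1 lam r1) (R2 lam r2) (R3 lam r3) := by
      unfold GG
      rw [smul_sub, smul_smul, smul_smul, mul_one, mul_inv_cancel₀ hne]
    rw [hscale, Matrix.det_smul]
    refine mul_ne_zero (pow_ne_zero _ hne) ?_
    have := @huv (lam⁻¹, ex lam, R1 lam r1, R2 lam r2, R3 lam r3) ⟨hεu ?_, hQv ⟨?_, ?_, ?_, ?_⟩⟩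
    · exact this
    · simp only [Metric.mem_ball, dist_zero_right, norm_inv]
      exact inv_lt_of_inv_lt₀ hε hL
    · intro k _
      simp only [Metric.mem_closedBall, dist_zero_right, ex, Complex.norm_exp]
      apply Real.exp_le_exp.2
      have : (-lam * (τ k : ℂ)).re = -lam.re * τ k := by simp
      rw [this]
      exact mul_le_mul_of_nonneg_right (by linarith) (hτpos k).le
    · exact hbd1 lam (by linarith) r1 p1 l1.1.1
    · exact hbd2 lam (by linarith) r2 p2 l2.1.2.1
    · exact hbd3 lam (by linarith) r3 p3 l3.1.2.2
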